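/- Under the hypotheses of the shuffle Leibniz rule, the induced product on homology H_•(U,A) of the complex (C_•(U,A), b) is well-defined, associative, and graded commutative, making H_•(U,A) a graded commutative k-algebra. -/

import Mathlib

open scoped TensorProduct
open PiTensorProduct

section

variable (A U : Type) [CommRing A] [CommRing U] [Algebra A U]

/-- The `i`-th face map of the simplicial module `C_•(U,A) = U^{⊗_A •}` of a commutative
left bialgebroid with counit `ε`, evaluated on a pure chain `(u¹,…,uᵐ)` (a family
`u : Fin m → U`); the result is recorded as a scalar in `A` together with a family of
`m-1` entries:
`d₀(u¹,…,uᵐ) = (u¹,…,ε(uᵐ)·u^{m-1})`, `dᵢ(u¹,…,uᵐ) = (u¹,…,u^{m-i}u^{m-i+1},…,uᵐ)`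
for `1 ≤ i ≤ m-1`, and `dₘ(u¹,…,uᵐ) = ε(u¹)·(u²,…,uᵐ)`. -/
noncomputable def faceF (ε : U →ₗ[A] A) (m : ℕ) (i : ℕ) (u : Fin m → U) :
    A × (Fin (m - 1) → U) :=
  if i = 0 then
    (if h1 : m = 1 then (ε (u ⟨0, by omega⟩), fun j => u (Fin.castLE (by omega) j))
     else
      (1, fun j =>
        if (j : ℕ) = m - 2 then
          ε (u ⟨m - 1, by have := j.isLt; omega⟩) • u ⟨j, by have := j.isLt; omega⟩
        else u ⟨j, by have := j.isLt; omega⟩))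
  else if i = m then
    (if h2 : 0 < m then ε (u ⟨0, h2⟩) else 1,
      fun j => u ⟨(j : ℕ) + 1, by have := j.isLt; omega⟩)
  else
    (1, fun j =>
      if (j : ℕ) < m - 1 - i then u ⟨j, by have := j.isLt; omega⟩
      else if (j : ℕ) = m - 1 - i then
        u ⟨j, by have := j.isLt; omega⟩ * u ⟨(j : ℕ) + 1, by have := j.isLt; omega⟩
      else u ⟨(j : ℕ) + 1, by have := j.isLt; omega⟩)

/-- The simplicial (Hochschild-type) boundary `b = Σᵢ (-1)ⁱ dᵢ` evaluated on a pure
chain `(u¹,…,uᵐ) ∈ C_m(U,A) = U^{⊗_A m}`. -/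
noncomputable def bdryF (ε : U →ₗ[A] A) (m : ℕ) (u : Fin m → U) :
    ⨂[A] (_ : Fin (m - 1)), U :=
  ∑ i ∈ Finset.range (m + 1),
    ((-1 : ℤ) ^ i) • ((faceF A U ε m i u).1 • tprod A (faceF A U ε m i u).2)

/-- `σ` is a `(p,q)`-shuffle: a permutation of `Fin (p+q)` strictly monotone on the
first `p` and on the last `q` indices. -/
def IsShuffle (p q : ℕ) (σ : Equiv.Perm (Fin (p + q))) : Prop :=
  (∀ i j : Fin (p + q), i < j → (j : ℕ) < p → σ i < σ j) ∧
  (∀ i j : Fin (p + q), i < j → p ≤ (i : ℕ) → σ i < σ j)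

open scoped Classical in
/-- The shuffle product
`(u¹,…,u^p) × (u^{p+1},…,u^{p+q}) = Σ_{σ ∈ Sh(p,q)} (-1)^σ (u^{σ⁻¹(1)},…,u^{σ⁻¹(p+q)})`
on the chains of a commutative left bialgebroid. -/
noncomputable def shuffleF (p q : ℕ) (u : Fin p → U) (v : Fin q → U) :
    ⨂[A] (_ : Fin (p + q)), U :=
  ∑ σ : Equiv.Perm (Fin (p + q)),
    if IsShuffle p q σ then
      ((Equiv.Perm.sign σ : ℤ)) • tprod A (fun j => Fin.append u v (σ⁻¹ j))
    else 0

end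

namespace ShufAux

set_option linter.unusedSectionVars false

section formal

variable {A U : Type} [CommRing A] [CommRing U] [Algebra A U]

/-- Formal combinations of words. -/
abbrev W (A U : Type) [CommRing A] := List U →₀ A

/-- The word `l` as a formal combination. -/
noncomputable def wd (A : Type) {U : Type} [CommRing A] (l : List U) : W A U := Finsupp.single l 1

/-- Linear extension of a function on words. -/
noncomputable def ext {M : Type} [AddCommGroup M] [Module A M] (f : List U → M) : W A U →ₗ[A] M :=
  Finsupp.linearCombination A f

@[simp] lemma ext_wd {M : Type} [AddCommGroup M] [Module A M] (f : List U → M) (l : List U) :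
    ext f (wd A l) = f l := by
  simp [ext, wd]

lemma hom_ext {M : Type} [AddCommGroup M] [Module A M] {f g : W A U →ₗ[A] M}
    (h : ∀ l, f (wd A l) = g (wd A l)) : f = g := by
  apply Finsupp.lhom_ext'
  intro l
  apply LinearMap.ext_ring
  exact h l

/-- Prepend a letter. -/
noncomputable def cn (a : U) : W A U →ₗ[A] W A U := ext (fun l => wd A (a :: l))

@[simp] lemma cn_wd (a : U) (l : List U) : cn a (wd A l) = wd A (a :: l) := by simp [cn]

/-- The degree twist. -/
noncomputable def tw : W A U →ₗ[A] W A U := ext (fun l => (-1 : A) ^ l.length • wd A l)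

@[simp] lemma tw_wd (l : List U) : tw (wd A l) = (-1 : A) ^ l.length • wd A l := by simp [tw]

lemma tw_cn (a : U) (X : W A U) : tw (cn a X) = - cn a (tw X) := by
  have : tw ∘ₗ cn a = - (cn a ∘ₗ (tw : W A U →ₗ[A] W A U)) := by
    apply hom_ext; intro l; simp [pow_succ]
  exact LinearMap.congr_fun this X

/-- Recursive signed shuffle of words. -/
noncomputable def sh : List U → List U → W A U
  | [], v => wd A v
  | a :: u, [] => wd A (a :: u)
  | a :: u, b :: v => cn a (sh u (b :: v)) + (-1 : A) ^ (u.length + 1) • cn b (sh (a :: u) v)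
termination_by u v => u.length + v.length

lemma sh_nil_left (v : List U) : sh [] v = wd A v := by simp [sh]
lemma sh_nil_right (v : List U) : sh v [] = wd A v := by cases v <;> simp [sh]
lemma sh_cons (a b : U) (u v : List U) : sh (A := A) (a :: u) (b :: v) =
    cn a (sh u (b :: v)) + (-1 : A) ^ (u.length + 1) • cn b (sh (a :: u) v) := by
  rw [sh]

/-- Bilinear extension. -/
noncomputable def Sh : W A U →ₗ[A] W A U →ₗ[A] W A U := ext (fun u => ext (fun v => sh u v))

@[simp] lemma Sh_wd (u v : List U) : Sh (wd A u) (wd A v) = sh u v := by simp [Sh]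

@[simp] lemma Sh_nil_left (Y : W A U) : Sh (wd A []) Y = Y := by
  have : Sh (wd A ([] : List U)) = LinearMap.id := by
    apply hom_ext; intro l; simp [sh_nil_left]
  rw [this]; rfl

@[simp] lemma Sh_nil_right (Y : W A U) : Sh Y (wd A []) = Y := by
  have : Sh.flip (wd A ([] : List U)) = LinearMap.id := by
    apply hom_ext; intro l; simp [sh_nil_right]
  exact LinearMap.congr_fun this Y

lemma Sh_cn_wd (a b : U) (u : List U) (Y : W A U) : Sh (cn a (wd A u)) (cn b Y) =
    cn a (Sh (wd A u) (cn b Y)) - (-1 : A) ^ u.length • cn b (Sh (cn a (wd A u)) Y) := by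
  have : Sh (cn a (wd A u)) ∘ₗ cn b = cn a ∘ₗ Sh (wd A u) ∘ₗ cn b
      - (-1 : A) ^ u.length • (cn b ∘ₗ Sh (cn a (wd A u))) := by
    apply hom_ext; intro v
    simp [sh_cons, pow_succ]
    module
  exact LinearMap.congr_fun this Y

lemma Sh_cn (a b : U) (X Y : W A U) : Sh (cn a X) (cn b Y) =
    cn a (Sh X (cn b Y)) - cn b (Sh (cn a (tw X)) Y) := by
  have : Sh.flip (cn b Y) ∘ₗ cn a = cn a ∘ₗ Sh.flip (cn b Y)
      - cn b ∘ₗ Sh.flip Y ∘ₗ cn a ∘ₗ tw := by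
    apply hom_ext; intro u
    simp only [LinearMap.comp_apply, LinearMap.sub_apply, LinearMap.flip_apply, Sh_cn_wd, tw_wd,
      map_smul, LinearMap.smul_apply]
  exact LinearMap.congr_fun this X

lemma sh_comm (u v : List U) : sh (A := A) u v = (-1 : A) ^ (u.length * v.length) • sh v u := by
  induction u, v using sh.induct with
  | case1 v => simp [sh_nil_left, sh_nil_right]
  | case2 a u => simp [sh_nil_left, sh_nil_right]
  | case3 a u b v h1 h2 =>
    rw [sh_cons, sh_cons, h1, h2]
    simp only [map_smul, smul_add, smul_smul, List.length_cons, ← pow_add]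
    rw [add_comm]
    congr 2
    · rw [← sub_eq_zero, show u.length + 1 + (u.length + 1) * v.length =
        (u.length + 1) * (v.length + 1) by ring]; simp
    · rw [show (u.length + 1) * (v.length + 1) + (v.length + 1) =
        u.length * (v.length + 1) + 2 * (v.length + 1) by ring, pow_add _ _ (2 * _)]
      simp

lemma tw_sh (u v : List U) : tw (sh (A := A) u v) = (-1 : A) ^ (u.length + v.length) • sh u v := by
  induction u, v using sh.induct with
  | case1 v => simp [sh_nil_left]
  | case2 a u => simp [sh_nil_right]
  | case3 a u b v h1 h2 =>
    rw [sh_cons]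
    simp only [map_add, map_smul, tw_cn, h1, h2, List.length_cons]
    simp only [smul_add, smul_neg, smul_smul, ← pow_add]
    simp only [← neg_smul]
    congr 2 <;> ring

lemma sh_assoc (u v w : List U) : Sh (sh (A := A) u v) (wd A w) = Sh (wd A u) (sh v w) := by
  induction hn : u.length + v.length + w.length using Nat.strong_induction_on
    generalizing u v w with
  | _ n ih =>
  subst hn
  match u, v, w with
  | [], v, w => simp [sh_nil_left]
  | u, [], w => simp [sh_nil_left, sh_nil_right]
  | u, v, [] => simp [sh_nil_right]
  | a :: u, b :: v, c :: w =>
    have i1 := ih _ (by simp) u (b :: v) (c :: w) rfl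
    have i2 := ih _ (by simp) (a :: u) v (c :: w) rfl
    have i3 := ih _ (by simp) (a :: u) (b :: v) w rfl
    have t1 := tw_sh (A := A) u (b :: v)
    have t2 := tw_sh (A := A) (a :: u) v
    have e1 := sh_cons (A := A) a b u v
    have e2 := sh_cons (A := A) b c v w
    have f1 : ∀ X Y : W A U, Sh (cn a X) (wd A (c :: w)) =
      cn a (Sh X (wd A (c :: w))) - cn c (Sh (cn a (tw X)) (wd A w)) := by
      intro X Y; have := Sh_cn a c X (wd A w); simpa using this
    have f2 : ∀ X : W A U, Sh (cn b X) (wd A (c :: w)) =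
      cn b (Sh X (wd A (c :: w))) - cn c (Sh (cn b (tw X)) (wd A w)) := by
      intro X; have := Sh_cn b c X (wd A w); simpa using this
    have f3 : ∀ X : W A U, Sh (wd A (a :: u)) (cn b X) =
      cn a (Sh (wd A u) (cn b X)) - (-1 : A) ^ u.length • cn b (Sh (wd A (a :: u)) X) := by
      intro X; have := Sh_cn_wd a b u X; simpa using this
    have f4 : ∀ X : W A U, Sh (wd A (a :: u)) (cn c X) =
      cn a (Sh (wd A u) (cn c X)) - (-1 : A) ^ u.length • cn c (Sh (wd A (a :: u)) X) := by
      intro X; have := Sh_cn_wd a c u X; simpa using this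
    rw [e2] at i1
    rw [e1] at i3
    rw [e1, e2]
    simp only [map_add, map_smul, LinearMap.add_apply, LinearMap.smul_apply, f2, f3, f4,
      f1 _ 0, t1, t2] at *
    rw [i2, i1, ← i3]
    simp only [map_add, map_smul, LinearMap.add_apply, LinearMap.smul_apply, List.length_cons,
      pow_add, pow_one]
    have s1 : ((-1 : A) ^ u.length) * ((-1 : A) ^ u.length) = 1 := by rw [← mul_pow]; simp
    have s2 : ((-1 : A) ^ v.length) * ((-1 : A) ^ v.length) = 1 := by rw [← mul_pow]; simp
    generalize (-1 : A) ^ u.length = s at *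
    generalize (-1 : A) ^ v.length = t at *
    module

variable (ε : U →ₗ[A] A)

/-- Multiply a letter into the first letter of a word. -/
noncomputable def st (a : U) : W A U →ₗ[A] W A U := ext fun
  | [] => ε a • wd A []
  | b :: l => wd A ((a * b) :: l)

lemma st_nil (a : U) : st ε a (wd A []) = ε a • wd A [] := by simp [st]
lemma st_cn (a b : U) (X : W A U) : st ε a (cn b X) = cn (a * b) X := by
  have : st ε a ∘ₗ cn b = cn (a * b) := by apply hom_ext; intro l; simp [st]
  exact LinearMap.congr_fun this X

/-- Drop the first letter. -/
noncomputable def E : W A U →ₗ[A] W A U := ext fun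
  | [] => 0
  | b :: l => ε b • wd A l

lemma E_nil : E ε (wd A []) = 0 := by simp [E]
lemma E_cn (b : U) (X : W A U) : E ε (cn b X) = ε b • X := by
  have : E ε ∘ₗ cn b = ε b • LinearMap.id := by apply hom_ext; intro l; simp [E]
  exact LinearMap.congr_fun this X

/-- The other faces. -/
noncomputable def nn : List U → W A U
  | [] => 0
  | a :: l => - cn a (nn l) - st ε a (wd A l)

/-- The other faces, linearly. -/
noncomputable def N : W A U →ₗ[A] W A U := ext (nn ε)

lemma N_nil : N ε (wd A []) = 0 := by simp [N, nn]
lemma N_cn (b : U) (X : W A U) : N ε (cn b X) = - cn b (N ε X) - st ε b X := by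
  have : N ε ∘ₗ cn b = - (cn b ∘ₗ N ε) - st ε b := by
    apply hom_ext; intro l; simp [N, nn]
  exact LinearMap.congr_fun this X

lemma tw_st (a : U) (X : W A U) : tw (st ε a X) = st ε a (tw X) := by
  have : tw ∘ₗ st ε a = st ε a ∘ₗ tw := by
    apply hom_ext; intro l
    cases l with
    | nil => simp [st_nil]
    | cons b l => rw [← cn_wd]; simp only [LinearMap.comp_apply, st_cn, tw_cn, tw_wd, map_neg,
        map_smul]
  exact LinearMap.congr_fun this X

lemma tw_N (l : List U) : tw (N ε (wd A l)) = - (-1 : A) ^ l.length • N ε (wd A l) := by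
  induction l with
  | nil => simp [N_nil]
  | cons a l ih =>
    rw [← cn_wd, N_cn]
    simp only [map_sub, map_neg, tw_cn, tw_st, ih, tw_wd, map_smul, List.length_cons, pow_succ]
    module

lemma E_sh (u v : List U) : E ε (sh u v) = Sh (E ε (wd A u)) (wd A v)
    + (-1 : A) ^ u.length • Sh (wd A u) (E ε (wd A v)) := by
  match u, v with
  | [], v => simp [sh_nil_left, E_nil]
  | u, [] => simp [sh_nil_right, E_nil]
  | a :: u, b :: v =>
    rw [sh_cons, ← cn_wd a u, ← cn_wd b v]
    simp only [map_add, map_smul, E_cn, LinearMap.smul_apply]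
    rw [cn_wd, cn_wd, Sh_wd, Sh_wd, List.length_cons]

lemma N_sh (u v : List U) : N ε (sh u v) = Sh (N ε (wd A u)) (wd A v)
    + (-1 : A) ^ u.length • Sh (wd A u) (N ε (wd A v)) := by
  induction u, v using sh.induct with
  | case1 v => simp [sh_nil_left, N_nil]
  | case2 a u => simp [sh_nil_right, N_nil]
  | case3 a u b v h1 h2 =>
    have s1 : ((-1 : A) ^ u.length) * ((-1 : A) ^ u.length) = 1 := by rw [← mul_pow]; simp
    have K1 : Sh (st ε a (wd A u)) (wd A (b :: v)) - st ε a (sh u (b :: v))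
        - (-1 : A) ^ u.length • cn b (Sh (st ε a (wd A u)) (wd A v))
        = - (-1 : A) ^ u.length • cn (a * b) (sh u v) := by
      cases u with
      | nil =>
        rw [sh_nil_left, st_nil, sh_nil_left, ← cn_wd, st_cn]; simp [sh_nil_left]
      | cons c u =>
        rw [sh_cons, ← cn_wd c u, ← cn_wd b v, map_add, map_smul, st_cn, st_cn, st_cn, Sh_cn_wd]
        simp only [List.length_cons, pow_succ, cn_wd, Sh_wd]
        module
    have K2 : Sh (wd A (a :: u)) (st ε b (wd A v)) - cn a (Sh (wd A u) (st ε b (wd A v)))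
        - st ε b (sh (a :: u) v) = - cn (a * b) (sh u v) := by
      cases v with
      | nil =>
        rw [sh_nil_right, st_nil, sh_nil_right, ← cn_wd, st_cn]; simp [mul_comm, sh_nil_right]
      | cons d v =>
        rw [sh_cons, ← cn_wd a u, ← cn_wd d v, map_add, map_smul, st_cn, st_cn, st_cn, Sh_cn_wd]
        simp only [pow_succ, cn_wd, Sh_wd, mul_comm b a]
        module
    rw [sh_cons]
    have n1 : N ε (wd A (a :: u)) = - cn a (N ε (wd A u)) - st ε a (wd A u) := by
      rw [← cn_wd, N_cn]
    have n2 : N ε (wd A (b :: v)) = - cn b (N ε (wd A v)) - st ε b (wd A v) := by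
      rw [← cn_wd, N_cn]
    have g1 : Sh (cn a (N ε (wd A u))) (wd A (b :: v)) = cn a (Sh (N ε (wd A u)) (wd A (b :: v)))
      + (-1 : A) ^ u.length • cn b (Sh (cn a (N ε (wd A u))) (wd A v)) := by
      rw [← cn_wd b v, Sh_cn, tw_N]; simp
    have g2 : Sh (wd A (a :: u)) (cn b (N ε (wd A v))) = cn a (Sh (wd A u) (cn b (N ε (wd A v))))
      - (-1 : A) ^ u.length • cn b (Sh (wd A (a :: u)) (N ε (wd A v))) := by
      rw [← cn_wd a u, Sh_cn_wd]
    simp only [map_add, map_smul, N_cn, h1, h2, n1, n2, map_sub, map_neg, LinearMap.sub_apply,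
      LinearMap.neg_apply, g1, g2, List.length_cons, pow_succ]
    generalize (-1 : A) ^ u.length = s at *
    linear_combination (norm := module) K1 - s • K2

/-- The formal differential. -/
noncomputable def D : W A U →ₗ[A] W A U := E ε + N ε

lemma D_sh (u v : List U) : D ε (sh u v) = Sh (D ε (wd A u)) (wd A v)
    + (-1 : A) ^ u.length • Sh (wd A u) (D ε (wd A v)) := by
  simp only [D, LinearMap.add_apply, E_sh, N_sh, map_add]
  module

end formal
end ShufAux

namespace ShufAux

set_option linter.unusedSectionVars false

section bridge

variable {A U : Type} [CommRing A] [CommRing U] [Algebra A U]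

/-- Homogeneous formal combinations. -/
noncomputable def H (A U : Type) [CommRing A] (n : ℕ) : Submodule A (W A U) :=
  Submodule.span A {x | ∃ l : List U, l.length = n ∧ x = wd A l}

lemma wd_mem (l : List U) {n : ℕ} (h : l.length = n) : wd A l ∈ H A U n :=
  Submodule.subset_span ⟨l, h, rfl⟩

lemma H_eq {M : Type} [AddCommGroup M] [Module A M] {n : ℕ} (f g : W A U →ₗ[A] M)
    (h : ∀ l : List U, l.length = n → f (wd A l) = g (wd A l)) {X : W A U} (hX : X ∈ H A U n) :
    f X = g X := by
  have : Set.EqOn f g {x | ∃ l : List U, l.length = n ∧ x = wd A l} := by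
    rintro x ⟨l, hl, rfl⟩; exact h l hl
  exact LinearMap.eqOn_span this hX

lemma H_map {n m : ℕ} (f : W A U →ₗ[A] W A U)
    (h : ∀ l : List U, l.length = n → f (wd A l) ∈ H A U m) {X : W A U} (hX : X ∈ H A U n) :
    f X ∈ H A U m := by
  have : H A U n ≤ (H A U m).comap f := by
    apply Submodule.span_le.2
    rintro x ⟨l, hl, rfl⟩; exact h l hl
  exact this hX

lemma cn_mem (a : U) {n : ℕ} {X : W A U} (hX : X ∈ H A U n) : cn a X ∈ H A U (n + 1) := by
  apply H_map _ _ hX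
  intro l hl; rw [cn_wd]; exact wd_mem _ (by simp [hl])

lemma sh_mem (u v : List U) : sh u v ∈ H A U (u.length + v.length) := by
  induction u, v using sh.induct with
  | case1 v => rw [sh_nil_left]; exact wd_mem _ (by simp)
  | case2 a u => rw [sh_nil_right]; exact wd_mem _ (by simp)
  | case3 a u b v h1 h2 =>
    rw [sh_cons]
    apply add_mem
    · have := cn_mem a h1
      convert this using 2
      simp; omega
    · exact Submodule.smul_mem _ _ (cn_mem b h2)

lemma Sh_mem {p q : ℕ} {X Y : W A U} (hX : X ∈ H A U p) (hY : Y ∈ H A U q) :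
    Sh X Y ∈ H A U (p + q) := by
  refine H_map (n := p) (Sh.flip Y) ?_ hX
  intro u hu
  refine H_map (n := q) (Sh (wd A u)) ?_ hY
  intro v hv
  rw [Sh_wd, ← hu, ← hv]
  exact sh_mem u v

variable (ε : U →ₗ[A] A)

lemma st_mem (a : U) (l : List U) : st ε a (wd A l) ∈ H A U l.length := by
  cases l with
  | nil => rw [st_nil]; exact Submodule.smul_mem _ _ (wd_mem _ rfl)
  | cons b l => rw [← cn_wd, st_cn, cn_wd]; exact wd_mem _ (by simp)

lemma N_mem (a : U) (l : List U) : N ε (wd A (a :: l)) ∈ H A U l.length := by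
  induction l generalizing a with
  | nil =>
    rw [← cn_wd, N_cn, N_nil, map_zero, neg_zero, zero_sub]
    exact neg_mem (st_mem ε a [])
  | cons b l ih =>
    rw [← cn_wd, N_cn]
    exact sub_mem (neg_mem (cn_mem a (ih b))) (st_mem ε a (b :: l))

lemma D_mem {n : ℕ} {X : W A U} (hX : X ∈ H A U (n + 1)) : D ε X ∈ H A U n := by
  refine H_map _ ?_ hX
  intro l hl
  match l, hl with
  | a :: l, hl =>
    have hl : l.length = n := by simpa using hl
    subst hl
    refine add_mem ?_ (N_mem ε a l)
    rw [← cn_wd, E_cn]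
    exact Submodule.smul_mem _ _ (wd_mem _ rfl)

/-- Evaluation of formal combinations of words in the tensor power. -/
noncomputable def ev (A : Type) {U : Type} [CommRing A] [CommRing U] [Algebra A U] (n : ℕ) :
    W A U →ₗ[A] ⨂[A] (_ : Fin n), U :=
  ext fun l => if h : l.length = n then tprod A (fun i : Fin n => l[(i : ℕ)]) else 0

lemma ev_ofFn {n : ℕ} (u : Fin n → U) : ev A n (wd A (List.ofFn u)) = tprod A u := by
  simp [ev]

lemma ev_surj {n : ℕ} (x : ⨂[A] (_ : Fin n), U) : ∃ X ∈ H A U n, ev A n X = x := by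
  induction x using PiTensorProduct.induction_on with
  | smul_tprod r u =>
    exact ⟨r • wd A (List.ofFn u), Submodule.smul_mem _ _ (wd_mem _ (by simp)), by
      rw [map_smul, ev_ofFn]⟩
  | add x y hx hy =>
    obtain ⟨X, h, rfl⟩ := hx
    obtain ⟨Y, hh, rfl⟩ := hy
    exact ⟨X + Y, add_mem h hh, map_add _ _ _⟩

lemma ev_reindex {m n : ℕ} (h : m = n) (X : W A U) :
    PiTensorProduct.reindex A (fun _ : Fin m => U) (finCongr h) (ev A m X) = ev A n X := by
  subst h
  have : finCongr (rfl : m = m) = Equiv.refl _ := by ext; simp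
  rw [this, PiTensorProduct.reindex_refl]
  rfl

/-- Permutation with `0 ↦ i`, and `k+1 ↦ i.succAbove (e k)`. -/
def bp {n : ℕ} (x : Fin (n + 1) × Equiv.Perm (Fin n)) : Equiv.Perm (Fin (n + 1)) :=
  (Fin.cycleRange x.1)⁻¹ * Equiv.Perm.decomposeFin.symm (0, x.2)

lemma bp_zero {n : ℕ} (i : Fin (n + 1)) (e : Equiv.Perm (Fin n)) : bp (i, e) 0 = i := by
  simp [bp]

lemma bp_succ {n : ℕ} (i : Fin (n + 1)) (e : Equiv.Perm (Fin n)) (k : Fin n) :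
    bp (i, e) k.succ = i.succAbove (e k) := by
  simp [bp]

lemma bp_sign {n : ℕ} (i : Fin (n + 1)) (e : Equiv.Perm (Fin n)) :
    (Equiv.Perm.sign (bp (i, e)) : ℤ) = (-1) ^ (i : ℕ) * Equiv.Perm.sign e := by
  simp [bp, Fin.sign_cycleRange]

lemma bp_bij {n : ℕ} : Function.Bijective (bp : Fin (n + 1) × Equiv.Perm (Fin n) → _) := by
  rw [Fintype.bijective_iff_injective_and_card]
  constructor
  · rintro ⟨i, e⟩ ⟨j, f⟩ h
    have h0 : i = j := by rw [← bp_zero i e, h, bp_zero]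
    subst h0
    congr 1
    ext k : 1
    have := bp_succ i e k
    rw [h, bp_succ] at this
    exact (Fin.succAbove_right_injective this).symm
  · simp [Fintype.card_perm, Nat.factorial_succ]

/-- Inverse shuffle condition. -/
def IS {n : ℕ} (p : ℕ) (t : Equiv.Perm (Fin n)) : Prop :=
  ∀ a b : Fin n, t a < t b → ((t b : ℕ) < p ∨ p ≤ (t a : ℕ)) → a < b

open scoped Classical in
/-- Formal sum over shuffles. -/
noncomputable def S (n p : ℕ) (w : Fin n → U) : W A U :=
  ∑ t : Equiv.Perm (Fin n),
    if IS p t then ((Equiv.Perm.sign t : ℤ) : A) • wd A (List.ofFn (w ∘ t)) else 0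

lemma IS_zero {n p : ℕ} (e : Equiv.Perm (Fin n)) : IS p (bp (0, e)) ↔ IS (p - 1) e := by
  constructor
  · intro h a b hab hp
    have := h a.succ b.succ
    simp only [bp_succ, Fin.zero_succAbove, Fin.succ_lt_succ_iff, Fin.val_succ] at this
    exact this hab (by omega)
  · intro h a b hab hp
    induction b using Fin.cases with
    | zero => simp [bp_zero] at hab
    | succ b =>
      induction a using Fin.cases with
      | zero => simp
      | succ a =>
        simp only [bp_succ, Fin.zero_succAbove, Fin.succ_lt_succ_iff, Fin.val_succ] at *
        exact h a b hab (by omega)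

lemma succAbove_val {n : ℕ} (i : Fin (n + 1)) (x : Fin n) :
    ((i.succAbove x : Fin (n + 1)) : ℕ) = if (x : ℕ) < i then (x : ℕ) else x + 1 := by
  simp only [Fin.succAbove, Fin.lt_def, Fin.val_castSucc]
  split_ifs <;> simp

lemma IS_p {n : ℕ} (i : Fin (n + 1)) (e : Equiv.Perm (Fin n)) :
    IS (i : ℕ) (bp (i, e)) ↔ IS (i : ℕ) e := by
  constructor
  · intro h a b hab hp
    have := h a.succ b.succ
    simp only [bp_succ, Fin.succAbove_lt_succAbove_iff, Fin.succ_lt_succ_iff, succAbove_val] at this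
    refine this hab ?_
    split_ifs <;> omega
  · intro h a b hab hp
    induction b using Fin.cases with
    | zero => rw [bp_zero] at hab hp; rw [Fin.lt_def] at hab; omega
    | succ b =>
      induction a using Fin.cases with
      | zero => simp
      | succ a =>
        simp only [bp_succ, Fin.succAbove_lt_succAbove_iff, Fin.succ_lt_succ_iff,
          succAbove_val] at *
        refine h a b hab ?_
        split_ifs at hp <;> omega

lemma IS_ne {n p : ℕ} (i : Fin (n + 1)) (e : Equiv.Perm (Fin n)) (h0 : i ≠ 0) (hp : (i : ℕ) ≠ p) :
    ¬ IS p (bp (i, e)) := by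
  intro h
  have hi : 0 < (i : ℕ) := Nat.pos_of_ne_zero (fun h => h0 (Fin.ext h))
  rcases lt_or_gt_of_ne hp with h1 | h1
  · have := h ((bp (i, e))⁻¹ 0) 0
    rw [show (bp (i, e)) ((bp (i, e))⁻¹ 0) = 0 by simp, bp_zero] at this
    exact absurd (this (by rw [Fin.lt_def]; simpa using hi) (Or.inl h1)) (by simp)
  · have hpn : p < n + 1 := by omega
    have := h ((bp (i, e))⁻¹ ⟨p, hpn⟩) 0
    rw [show (bp (i, e)) ((bp (i, e))⁻¹ ⟨p, hpn⟩) = ⟨p, hpn⟩ by simp, bp_zero] at this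
    exact absurd (this (by rw [Fin.lt_def]; exact h1) (Or.inr le_rfl)) (by simp)

lemma ofFn_bp {n : ℕ} (w : Fin (n + 1) → U) (i : Fin (n + 1)) (e : Equiv.Perm (Fin n)) :
    List.ofFn (w ∘ bp (i, e)) = w i :: List.ofFn ((w ∘ i.succAbove) ∘ e) := by
  rw [List.ofFn_succ]
  simp [bp_zero, bp_succ, Function.comp_def]

open scoped Classical in
lemma S_succ (n p : ℕ) (w : Fin (n + 1) → U) : S (A := A) (n + 1) p w =
    ∑ i : Fin (n + 1), if i = 0 then cn (w 0) (S n (p - 1) (w ∘ Fin.succ)) else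
      if (i : ℕ) = p then (-1 : A) ^ p • cn (w i) (S n p (w ∘ i.succAbove)) else 0 := by
  rw [S, ← bp_bij.sum_comp, Fintype.sum_prod_type]
  refine Finset.sum_congr rfl fun i _ => ?_
  split_ifs with h1 h2
  · subst h1
    simp only [IS_zero, S, map_sum]
    refine Finset.sum_congr rfl fun e _ => ?_
    split_ifs
    · rw [map_smul, cn_wd, ofFn_bp, bp_sign]
      simp [Function.comp_def]
    · simp
  · subst h2
    simp only [IS_p, S, map_sum, Finset.smul_sum]
    refine Finset.sum_congr rfl fun e _ => ?_
    split_ifs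
    · rw [map_smul, cn_wd, ofFn_bp, bp_sign, smul_smul]
      simp
    · simp
  · refine Finset.sum_eq_zero fun e _ => ?_
    rw [if_neg (IS_ne i e h1 h2)]

lemma ofFn_succAbove {n : ℕ} (w : Fin (n + 1) → U) (i : Fin (n + 1)) :
    List.ofFn (w ∘ i.succAbove) = (List.ofFn w).eraseIdx i := by
  apply List.ext_getElem
  · have := i.isLt
    simp [List.length_eraseIdx]; omega
  · intro k h1 h2
    simp only [List.getElem_ofFn, List.getElem_eraseIdx, Function.comp_apply]
    split_ifs with h
    · congr 1; ext; rw [succAbove_val]; simp [h]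
    · congr 1; ext; rw [succAbove_val]; simp [h]

lemma S_eq (n p : ℕ) (hp : p ≤ n) (w : Fin n → U) :
    S (A := A) n p w = sh ((List.ofFn w).take p) ((List.ofFn w).drop p) := by
  induction n generalizing p with
  | zero =>
    have : IS p (1 : Equiv.Perm (Fin 0)) := fun a => a.elim0
    simp [S, sh_nil_left, this, Subsingleton.elim _ (1 : Equiv.Perm (Fin 0))]
  | succ n ih =>
    rw [S_succ]
    rcases Nat.eq_zero_or_pos p with h0 | h0
    · subst h0
      rw [Fin.sum_univ_succ]
      simp [ih, sh_nil_left, List.ofFn_succ, Function.comp_def]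
    obtain ⟨p, rfl⟩ : ∃ k, p = k + 1 := ⟨p - 1, by omega⟩
    rcases Nat.lt_or_ge n (p + 1) with h1 | h1
    · have : p = n := by omega
      subst this
      rw [Fin.sum_univ_succ, Finset.sum_eq_zero]
      · rw [if_pos rfl, add_zero, ih _ (by omega)]
        simp [List.drop_eq_nil_of_le, List.take_of_length_le, sh_nil_right, List.ofFn_succ,
          Function.comp_def]
      · intro i _
        have := i.isLt
        rw [if_neg (Fin.succ_ne_zero _), if_neg]
        simp; omega
    · have hlt : p < n := h1
      rw [Fin.sum_univ_succ, if_pos rfl, Finset.sum_eq_single (⟨p, hlt⟩ : Fin n)]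
      · rw [if_neg (Fin.succ_ne_zero _), if_pos (by simp), ih _ (by omega), ih _ h1,
          ofFn_succAbove]
        have e1 : (List.ofFn w).take (p + 1) = w 0 :: (List.ofFn (w ∘ Fin.succ)).take p := by
          simp [List.ofFn_succ, Function.comp_def]
        have e2 : (List.ofFn w).drop (p + 1) =
            w (Fin.succ ⟨p, hlt⟩) :: (List.ofFn w).drop (p + 2) := by
          rw [List.drop_eq_getElem_cons (by simp; omega)]
          simp [Fin.succ]
        have e3 : (List.ofFn (w ∘ Fin.succ)).drop p = (List.ofFn w).drop (p + 1) := by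
          simp [List.ofFn_succ, Function.comp_def]
        have e4 : ((List.ofFn w).eraseIdx (Fin.succ ⟨p, hlt⟩ : Fin (n + 1))).take (p + 1)
            = (List.ofFn w).take (p + 1) := by
          rw [List.eraseIdx_eq_take_drop_succ, List.take_append_of_le_length (by simp; omega)]
          simp
        have e5 : ((List.ofFn w).eraseIdx (Fin.succ ⟨p, hlt⟩ : Fin (n + 1))).drop (p + 1)
            = (List.ofFn w).drop (p + 2) := by
          rw [List.eraseIdx_eq_take_drop_succ, List.drop_append_of_le_length (by simp; omega)]
          simp
        have e6 : ((List.ofFn (w ∘ Fin.succ)).take p).length = p := by simp; omega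
        rw [Nat.add_sub_cancel, e4, e5, e3, e1, e2, sh_cons, e6]
      · intro i _ hi
        rw [if_neg (Fin.succ_ne_zero _), if_neg]
        intro h
        apply hi
        ext
        simpa using h
      · simp

lemma shuffleF_eq (p q : ℕ) (u : Fin p → U) (v : Fin q → U) :
    shuffleF A U p q u v = ev A (p + q) (sh (List.ofFn u) (List.ofFn v)) := by
  have h1 : (List.ofFn (Fin.append u v)).take p = List.ofFn u := by
    rw [List.ofFn_fin_append]; simp
  have h2 : (List.ofFn (Fin.append u v)).drop p = List.ofFn v := by
    rw [List.ofFn_fin_append]; simp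
  have := S_eq (A := A) (p + q) p (by omega) (Fin.append u v)
  rw [h1, h2] at this
  rw [← this, S, map_sum, shuffleF, ← Equiv.sum_comp (Equiv.inv (Equiv.Perm (Fin (p + q))))]
  refine Finset.sum_congr rfl fun t _ => ?_
  have key : IsShuffle p q t⁻¹ ↔ IS p t := by
    constructor
    · intro h a b hab hp
      rcases hp with hp | hp
      · simpa using h.1 _ _ hab hp
      · simpa using h.2 _ _ hab hp
    · intro h
      exact ⟨fun i j hij hj => h _ _ (by simpa using hij) (Or.inl (by simpa using hj)),
        fun i j hij hj => h _ _ (by simpa using hij) (Or.inr (by simpa using hj))⟩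
  rw [show (Equiv.inv (Equiv.Perm (Fin (p + q)))) t = t⁻¹ from rfl]
  by_cases h : IS p t
  · rw [if_pos h, if_pos (key.2 h), map_smul, ev_ofFn, Int.cast_smul_eq_zsmul]
    simp only [Equiv.Perm.sign_inv, inv_inv, Function.comp_def]
  · rw [if_neg h, if_neg (fun hk => h (key.1 hk)), map_zero]

end bridge
end ShufAux

namespace ShufAux

set_option linter.unusedSectionVars false

section bdry

variable {A U : Type} [CommRing A] [CommRing U] [Algebra A U]

/-- Multiply the letters number `j` and `j+1`. -/
def mulAt : ℕ → List U → List U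
  | 0, a :: b :: l => (a * b) :: l
  | j + 1, a :: l => a :: mulAt j l
  | _, _ => []

lemma mulAt_length (j : ℕ) (l : List U) (h : j + 1 < l.length) :
    (mulAt j l).length = l.length - 1 := by
  induction j generalizing l with
  | zero =>
    match l, h with
    | a :: b :: l, h => simp [mulAt]
  | succ j ih =>
    match l, h with
    | a :: l, h =>
      have h : j + 1 < l.length := by simpa using h
      simp [mulAt, ih l h]; omega

lemma mulAt_getElem (j : ℕ) (l : List U) (h : j + 1 < l.length) (i : ℕ) (hi : i + 1 < l.length)
    (hj : i < (mulAt j l).length) :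
    (mulAt j l)[i] = if i < j then l[i] else if i = j then l[i] * l[i + 1] else l[i + 1] := by
  induction j generalizing l i with
  | zero =>
    match l, h with
    | a :: b :: l, h =>
      cases i <;> simp [mulAt]
  | succ j ih =>
    match l, h with
    | a :: l, h =>
      have h : j + 1 < l.length := by simpa using h
      cases i with
      | zero => simp [mulAt]
      | succ i =>
        have := ih l h i (by simpa using hi) (by rw [mulAt_length _ _ h]; simp at hi; omega)
        simp [mulAt, this]

variable (ε : U →ₗ[A] A)

lemma nn_eq (a : U) (l : List U) : nn ε (a :: l) =
    ∑ j ∈ Finset.range l.length, (-1 : A) ^ (j + 1) • wd A (mulAt j (a :: l))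
      + (-1 : A) ^ (l.length + 1) • ε ((a :: l).getLast (by simp)) • wd A ((a :: l).dropLast) := by
  induction l generalizing a with
  | nil => simp [nn, st_nil]
  | cons b l ih =>
    rw [nn, ih b, ← cn_wd b l, st_cn, List.length_cons, Finset.sum_range_succ']
    simp only [map_add, map_sum, map_smul, cn_wd, mulAt, pow_succ, List.getLast_cons_cons,
      List.dropLast_cons_cons]
    have : ∀ j, ((-1 : A) ^ j * -1 * -1) • wd A (a :: mulAt j (b :: l)) =
      - (((-1 : A) ^ j * -1) • wd A (a :: mulAt j (b :: l))) := by intro j; module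
    simp only [this, Finset.sum_neg_distrib]
    module

lemma ev_tprod {n : ℕ} (l : List U) (f : Fin n → U) (hl : l.length = n)
    (h : ∀ i (hi : i < n), l[i]'(by omega) = f ⟨i, hi⟩) : ev A n (wd A l) = tprod A f := by
  have : l = List.ofFn f := by
    apply List.ext_getElem
    · simp [hl]
    · intro i h1 h2
      simp [h i (by omega)]
  rw [this, ev_ofFn]

lemma T1 (m : ℕ) (u : Fin (m + 1) → U) :
    (faceF A U ε (m + 1) (m + 1) u).1 • tprod A (faceF A U ε (m + 1) (m + 1) u).2
      = ev A m (E ε (wd A (List.ofFn u))) := by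
  rw [List.ofFn_succ, ← cn_wd, E_cn, map_smul, ev_ofFn]
  simp [faceF]
  rfl

lemma T2 (m : ℕ) (u : Fin (m + 1) → U) (k : ℕ) (hk : k < m) :
    (faceF A U ε (m + 1) (m - k) u).1 • tprod A (faceF A U ε (m + 1) (m - k) u).2
      = ev A m (wd A (mulAt k (List.ofFn u))) := by
  have h1 : m - k ≠ 0 := by omega
  have h2 : m - k ≠ m + 1 := by omega
  have h3 : m + 1 - 1 - (m - k) = k := by omega
  rw [faceF, if_neg h1, if_neg h2]
  simp only [one_smul]
  symm
  refine ev_tprod _ _ ?_ ?_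
  · rw [mulAt_length]
    · simp
    · simpa using hk
  · intro i hi
    rw [mulAt_getElem _ _ (by simpa using hk) _ (by simpa using hi)]
    simp only [List.getElem_ofFn, h3]

lemma T3 (m : ℕ) (u : Fin (m + 1) → U) :
    (faceF A U ε (m + 1) 0 u).1 • tprod A (faceF A U ε (m + 1) 0 u).2
      = ev A m (ε (u (Fin.last m)) • wd A (List.ofFn u).dropLast) := by
  have hd : ev A m (wd A (List.ofFn u).dropLast) = tprod A (fun i : Fin m => u i.castSucc) := by
    refine ev_tprod _ _ ?_ ?_
    · simp
    · intro i hi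
      simp only [List.getElem_dropLast, List.getElem_ofFn]
      rfl
  rw [map_smul, hd]
  cases m with
  | zero =>
    simp [faceF]
    congr 1
  | succ m =>
    have e : (faceF A U ε (m + 1 + 1) 0 u) = (1, Function.update (fun i : Fin (m + 1) => u i.castSucc)
        (Fin.last m) (ε (u (Fin.last (m + 1))) • u (Fin.last m).castSucc)) := by
      simp only [faceF, if_true]
      rw [dif_neg (by omega)]
      congr 1
      funext j
      by_cases hj : j = Fin.last m
      · subst hj
        simp
        rfl
      · have : (j : ℕ) ≠ m := fun h => hj (Fin.ext h)
        rw [Function.update_of_ne hj, if_neg (by simpa using this)]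
        rfl
    rw [e]
    simp only [one_smul]
    have := (PiTensorProduct.tprod A).map_update_smul (fun i : Fin (m + 1) => u i.castSucc) (Fin.last m)
      (ε (u (Fin.last (m + 1)))) (u (Fin.last m).castSucc)
    refine this.trans ?_
    congr 2
    exact Function.update_eq_self _ _

lemma alt_sum {M : Type} [AddCommGroup M] [Module A M] (m : ℕ) (t : ℕ → M) :
    ∑ i ∈ Finset.range (m + 1 + 1), (-1 : A) ^ i • t i = (-1 : A) ^ (m + 1) • (t (m + 1) +
      (∑ j ∈ Finset.range m, (-1 : A) ^ (j + 1) • t (m - j) + (-1 : A) ^ (m + 1) • t 0)) := by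
  have sq : ∀ k : ℕ, (-1 : A) ^ k * (-1 : A) ^ k = 1 := by
    intro k; rw [← mul_pow]; simp
  rw [← Finset.sum_range_reflect, Finset.sum_range_succ, Finset.sum_range_succ', smul_add,
    smul_add, Finset.smul_sum, add_comm (Finset.sum _ _) (_ • _), add_assoc]
  congr 1
  congr 1
  · refine Finset.sum_congr rfl fun j hj => ?_
    have hj := Finset.mem_range.1 hj
    rw [show m + 1 + 1 - 1 - (j + 1) = m - j by omega, smul_smul]
    congr 1
    rw [show m + 1 = (m - j) + (j + 1) by omega, pow_add, mul_assoc, sq, mul_one]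
  · rw [show m + 1 + 1 - 1 - (m + 1) = 0 by omega, smul_smul, sq]
    simp

lemma bdryF_eq (m : ℕ) (u : Fin (m + 1) → U) :
    bdryF A U ε (m + 1) u = (-1 : A) ^ (m + 1) • ev A m (D ε (wd A (List.ofFn u))) := by
  have hN : N ε (wd A (List.ofFn u)) = ∑ j ∈ Finset.range m,
      (-1 : A) ^ (j + 1) • wd A (mulAt j (List.ofFn u))
      + (-1 : A) ^ (m + 1) • ε (u (Fin.last m)) • wd A ((List.ofFn u).dropLast) := by
    have := nn_eq ε (u 0) (List.ofFn fun i : Fin m => u i.succ)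
    rw [N, ext_wd]
    have e : List.ofFn u = u 0 :: (List.ofFn fun i : Fin m => u i.succ) := List.ofFn_succ
    have g : (List.ofFn u).getLast (by simp) = u (Fin.last m) := by
      rw [List.getLast_ofFn]; rfl
    simp only [← e, List.length_ofFn] at this
    rw [this, g]
  rw [D, LinearMap.add_apply, map_add, hN, ← T1, map_add, map_smul, ← T3, map_sum]
  have h2 : ∀ j ∈ Finset.range m, ev A m ((-1 : A) ^ (j + 1) • wd A (mulAt j (List.ofFn u))) =
      (-1 : A) ^ (j + 1) • ((faceF A U ε (m + 1) (m - j) u).1 •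
        tprod A (faceF A U ε (m + 1) (m - j) u).2) := by
    intro j hj
    rw [map_smul, T2 ε m u j (Finset.mem_range.1 hj)]
  rw [Finset.sum_congr rfl h2, bdryF]
  have hz : ∀ i (x : ⨂[A] (_ : Fin (m + 1 - 1)), U), ((-1 : ℤ) ^ i) • x = ((-1 : A) ^ i) • x := by
    intro i x
    rw [← Int.cast_smul_eq_zsmul A]; simp
  simp only [hz]
  exact alt_sum m (fun i => (faceF A U ε (m + 1) i u).1 • tprod A (faceF A U ε (m + 1) i u).2)

lemma Sh_assoc {p q r : ℕ} {X Y Z : W A U} (hX : X ∈ H A U p) (hY : Y ∈ H A U q)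
    (hZ : Z ∈ H A U r) : Sh (Sh X Y) Z = Sh X (Sh Y Z) := by
  refine H_eq (Sh.flip Z ∘ₗ Sh.flip Y) (Sh.flip (Sh Y Z)) ?_ hX
  intro u _
  refine H_eq (Sh.flip Z ∘ₗ Sh (wd A u)) (Sh (wd A u) ∘ₗ Sh.flip Z) ?_ hY
  intro v _
  refine H_eq (Sh (Sh (wd A u) (wd A v))) (Sh (wd A u) ∘ₗ Sh (wd A v)) ?_ hZ
  intro w _
  simp only [LinearMap.comp_apply, Sh_wd]
  exact sh_assoc u v w

lemma Sh_comm {p q : ℕ} {X Y : W A U} (hX : X ∈ H A U p) (hY : Y ∈ H A U q) :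
    Sh X Y = (((-1 : ℤ) ^ (p * q) : ℤ) : A) • Sh Y X := by
  refine H_eq (Sh.flip Y) ((((-1 : ℤ) ^ (p * q) : ℤ) : A) • Sh Y) ?_ hX
  intro u hu
  refine H_eq (Sh (wd A u)) ((((-1 : ℤ) ^ (p * q) : ℤ) : A) • Sh.flip (wd A u)) ?_ hY
  intro v hv
  have := sh_comm (A := A) u v
  rw [hu, hv] at this
  simpa using this

end bdry
end ShufAux
/-- Let `U` be a commutative left bialgebroid over a commutative
`k`-algebra `A`, with simplicial boundary `b` (any linear extension `bLin` of the
pure-chain formula `bdryF`) and shuffle product `×` (any bilinear extension `shLin` of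
the pure-chain formula `shuffleF`). Then the induced product on the homology of
`(C_•(U,A), b)` is well-defined (cycles are closed under `×`, and boundaries are
absorbed), associative, and graded commutative, making `H_•(U,A)` a graded commutative
algebra (associativity and commutativity stated modulo boundaries). -/
theorem shuffle_product_homology_graded_commutative_algebra
    (A U : Type) [CommRing A] [CommRing U] [Algebra A U]
    (ε : U →ₗ[A] A) (hε1 : ε 1 = 1)
    (bLin : ∀ m : ℕ, (⨂[A] (_ : Fin m), U) →ₗ[A] ⨂[A] (_ : Fin (m - 1)), U)
    (hbLin : ∀ (m : ℕ) (u : Fin m → U), bLin m (tprod A u) = bdryF A U ε m u)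
    (shLin : ∀ p q : ℕ,
      (⨂[A] (_ : Fin p), U) →ₗ[A] (⨂[A] (_ : Fin q), U) →ₗ[A] ⨂[A] (_ : Fin (p + q)), U)
    (hshLin : ∀ (p q : ℕ) (u : Fin p → U) (v : Fin q → U),
      shLin p q (tprod A u) (tprod A v) = shuffleF A U p q u v) :
    -- the product of cycles is a cycle
    (∀ (p q : ℕ) (x : ⨂[A] (_ : Fin p), U) (y : ⨂[A] (_ : Fin q), U),
      bLin p x = 0 → bLin q y = 0 → bLin (p + q) (shLin p q x y) = 0) ∧
    -- the product of a boundary with a cycle is a boundary (so the product descends)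
    (∀ (p q : ℕ) (z : ⨂[A] (_ : Fin (p + 1)), U) (y : ⨂[A] (_ : Fin q), U),
      bLin q y = 0 → ∃ w, shLin p q (bLin (p + 1) z) y = bLin (p + q + 1) w) ∧
    (∀ (p q : ℕ) (x : ⨂[A] (_ : Fin p), U) (z : ⨂[A] (_ : Fin (q + 1)), U),
      bLin p x = 0 → ∃ w, shLin p q x (bLin (q + 1) z) = bLin (p + q + 1) w) ∧
    -- associativity on homology
    (∀ (p q r : ℕ) (x : ⨂[A] (_ : Fin p), U) (y : ⨂[A] (_ : Fin q), U)
        (z : ⨂[A] (_ : Fin r), U),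
      bLin p x = 0 → bLin q y = 0 → bLin r z = 0 →
      ∃ w, shLin (p + q) r (shLin p q x y) z
          - (PiTensorProduct.reindex A (fun _ : Fin (p + (q + r)) => U)
              (finCongr (by omega))) (shLin p (q + r) x (shLin q r y z))
        = bLin (p + q + r + 1) w) ∧
    -- graded commutativity on homology
    (∀ (p q : ℕ) (x : ⨂[A] (_ : Fin p), U) (y : ⨂[A] (_ : Fin q), U),
      bLin p x = 0 → bLin q y = 0 →
      ∃ w, shLin p q x y
          - ((-1 : ℤ) ^ (p * q)) •
            (PiTensorProduct.reindex A (fun _ : Fin (q + p) => U)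
              (finCongr (by omega))) (shLin q p y x)
        = bLin (p + q + 1) w) := by
  classical
  have list_ofFn : ∀ (n : ℕ) (l : List U), l.length = n → ∃ u : Fin n → U, l = List.ofFn u := by
    intro n l hl
    subst hl
    exact ⟨l.get, (List.ofFn_get l).symm⟩
  have hb : ∀ (m : ℕ) (X : ShufAux.W A U), X ∈ ShufAux.H A U (m + 1) →
      bLin (m + 1) (ShufAux.ev A (m + 1) X)
        = (-1 : A) ^ (m + 1) • ShufAux.ev A m (ShufAux.D ε X) := by
    intro m X hX
    refine ShufAux.H_eq (bLin (m + 1) ∘ₗ ShufAux.ev A (m + 1))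
      ((-1 : A) ^ (m + 1) • (ShufAux.ev A m ∘ₗ ShufAux.D ε)) ?_ hX
    intro l hl
    obtain ⟨u, rfl⟩ := list_ofFn _ l hl
    simp only [LinearMap.comp_apply, LinearMap.smul_apply]
    rw [ShufAux.ev_ofFn, hbLin, ShufAux.bdryF_eq]
  have hs : ∀ (p q : ℕ) (X Y : ShufAux.W A U), X ∈ ShufAux.H A U p → Y ∈ ShufAux.H A U q →
      shLin p q (ShufAux.ev A p X) (ShufAux.ev A q Y) = ShufAux.ev A (p + q) (ShufAux.Sh X Y) := by
    intro p q X Y hX hY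
    refine ShufAux.H_eq ((shLin p q).flip (ShufAux.ev A q Y) ∘ₗ ShufAux.ev A p)
      (ShufAux.ev A (p + q) ∘ₗ ShufAux.Sh.flip Y) ?_ hX
    intro l hl
    obtain ⟨u, rfl⟩ := list_ofFn _ l hl
    refine ShufAux.H_eq (shLin p q (ShufAux.ev A p (ShufAux.wd A (List.ofFn u))) ∘ₗ ShufAux.ev A q)
      (ShufAux.ev A (p + q) ∘ₗ ShufAux.Sh (ShufAux.wd A (List.ofFn u))) ?_ hY
    intro l hl
    obtain ⟨v, rfl⟩ := list_ofFn _ l hl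
    simp only [LinearMap.comp_apply]
    rw [ShufAux.ev_ofFn, ShufAux.ev_ofFn, hshLin, ShufAux.Sh_wd, ShufAux.shuffleF_eq]
  have hD : ∀ (p : ℕ) (X Y : ShufAux.W A U), X ∈ ShufAux.H A U p →
      ShufAux.D ε (ShufAux.Sh X Y) = ShufAux.Sh (ShufAux.D ε X) Y
        + (-1 : A) ^ p • ShufAux.Sh X (ShufAux.D ε Y) := by
    intro p X Y hX
    refine ShufAux.H_eq (ShufAux.D ε ∘ₗ ShufAux.Sh.flip Y)
      (ShufAux.Sh.flip Y ∘ₗ ShufAux.D ε + (-1 : A) ^ p • ShufAux.Sh.flip (ShufAux.D ε Y)) ?_ hX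
    intro u hu
    have : ShufAux.D ε ∘ₗ ShufAux.Sh (ShufAux.wd A u) =
        ShufAux.Sh (ShufAux.D ε (ShufAux.wd A u))
        + (-1 : A) ^ p • (ShufAux.Sh (ShufAux.wd A u) ∘ₗ ShufAux.D ε) := by
      apply ShufAux.hom_ext
      intro v
      have := ShufAux.D_sh ε u v
      rw [hu] at this
      simpa using this
    exact LinearMap.congr_fun this Y
  have hb0 : ∀ x : ⨂[A] (_ : Fin 0), U, bLin 0 x = 0 → x = 0 := by
    have : ∀ x : ⨂[A] (_ : Fin 0), U, bLin 0 x = x := by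
      intro x
      induction x using PiTensorProduct.induction_on with
      | smul_tprod r u =>
        rw [map_smul, hbLin]
        congr 1
        simp only [bdryF, faceF]
        simp
        congr 1
        funext i
        exact i.elim0
      | add x y hx hy => rw [map_add, hx, hy]
    intro x hx
    rw [← this x, hx]
  have sq : ∀ k : ℕ, (-1 : A) ^ k * (-1 : A) ^ k = 1 := by
    intro k; rw [← mul_pow]; simp
  have hz : ∀ (m : ℕ) (X : ShufAux.W A U), X ∈ ShufAux.H A U (m + 1) →
      bLin (m + 1) (ShufAux.ev A (m + 1) X) = 0 → ShufAux.ev A m (ShufAux.D ε X) = 0 := by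
    intro m X hX h
    rw [hb m X hX] at h
    have := congrArg (fun z => (-1 : A) ^ (m + 1) • z) h
    simpa [smul_smul, sq] using this
  have hcast : ∀ (m n : ℕ) (h : m = n) (X : ShufAux.W A U), ShufAux.ev A m X = 0 →
      ShufAux.ev A n X = 0 := by
    intro m n h X hX
    subst h
    exact hX
  -- the two halves of the Leibniz rule, vanishing on cycles
  have hL : ∀ (p q : ℕ) (X Y : ShufAux.W A U), X ∈ ShufAux.H A U (p + 1) → Y ∈ ShufAux.H A U q →
      bLin (p + 1) (ShufAux.ev A (p + 1) X) = 0 →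
      ShufAux.ev A (p + q) (ShufAux.Sh (ShufAux.D ε X) Y) = 0 := by
    intro p q X Y hX hY h
    rw [← hs p q _ _ (ShufAux.D_mem ε hX) hY, hz p X hX h]
    simp
  have hR : ∀ (p q : ℕ) (X Y : ShufAux.W A U), X ∈ ShufAux.H A U p → Y ∈ ShufAux.H A U (q + 1) →
      bLin (q + 1) (ShufAux.ev A (q + 1) Y) = 0 →
      ShufAux.ev A (p + q) (ShufAux.Sh X (ShufAux.D ε Y)) = 0 := by
    intro p q X Y hX hY h
    rw [← hs p q _ _ hX (ShufAux.D_mem ε hY), hz q Y hY h]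
    simp
  refine ⟨?_, ?_, ?_, ?_, ?_⟩
  · intro p q x y hx hy
    rcases p with _ | p
    · rw [hb0 x hx]; simp
    rcases q with _ | q
    · rw [hb0 y hy]; simp
    obtain ⟨X, hX, rfl⟩ := ShufAux.ev_surj x
    obtain ⟨Y, hY, rfl⟩ := ShufAux.ev_surj y
    rw [hs _ _ _ _ hX hY]
    have e1 := hcast (p + (q + 1)) (p + 1 + q) (by omega) _ (hL p (q + 1) _ _ hX hY hx)
    have e2 := hR (p + 1) q _ _ hX hY hy
    have hm : ShufAux.Sh X Y ∈ ShufAux.H A U (p + 1 + q + 1) :=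
      ShufAux.Sh_mem (p := p + 1) (q := q + 1) hX hY
    have e3 : bLin (p + 1 + q + 1) (ShufAux.ev A (p + 1 + q + 1) (ShufAux.Sh X Y)) = 0 := by
      rw [hb _ _ hm, hD _ _ _ hX, map_add, map_smul, e1, e2, smul_zero, add_zero, smul_zero]
    exact e3
  · intro p q z y hy
    rcases q with _ | q
    · exact ⟨0, by rw [hb0 y hy]; simp⟩
    obtain ⟨Z, hZ, rfl⟩ := ShufAux.ev_surj z
    obtain ⟨Y, hY, rfl⟩ := ShufAux.ev_surj y
    have hm : ShufAux.Sh Z Y ∈ ShufAux.H A U (p + (q + 1) + 1) := by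
      have := ShufAux.Sh_mem hZ hY
      rwa [show p + 1 + (q + 1) = p + (q + 1) + 1 by omega] at this
    have e1 := hcast (p + 1 + q) (p + (q + 1)) (by omega) _ (hR (p + 1) q _ _ hZ hY hy)
    refine ⟨(-1 : A) ^ (q + 1) • ShufAux.ev A _ (ShufAux.Sh Z Y), ?_⟩
    rw [map_smul, hb _ _ hm, hb _ _ hZ, hD _ _ _ hZ, map_add,
      map_smul (ShufAux.ev A (p + (q + 1))), e1, map_smul, LinearMap.smul_apply,
      hs _ _ _ _ (ShufAux.D_mem ε hZ) hY, smul_zero, add_zero, smul_smul]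
    congr 1
    rw [show p + (q + 1) + 1 = (q + 1) + (p + 1) by omega, pow_add _ (q + 1) (p + 1), ← mul_assoc,
      sq, one_mul]
  · intro p q x z hx
    rcases p with _ | p
    · exact ⟨0, by rw [hb0 x hx]; simp⟩
    obtain ⟨X, hX, rfl⟩ := ShufAux.ev_surj x
    obtain ⟨Z, hZ, rfl⟩ := ShufAux.ev_surj z
    have hm : ShufAux.Sh X Z ∈ ShufAux.H A U (p + 1 + q + 1) :=
      ShufAux.Sh_mem (p := p + 1) (q := q + 1) hX hZ
    have e1 := hcast (p + (q + 1)) (p + 1 + q) (by omega) _ (hL p (q + 1) _ _ hX hZ hx)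
    refine ⟨ShufAux.ev A _ (ShufAux.Sh X Z), ?_⟩
    rw [hb _ _ hm, hb _ _ hZ, hD _ _ _ hX, map_add, map_smul,
      e1, map_smul,
      hs _ _ _ _ hX (ShufAux.D_mem ε hZ), zero_add, smul_smul]
    congr 1
    rw [show p + 1 + q + 1 = (q + 1) + (p + 1) by omega, pow_add _ (q + 1) (p + 1), mul_assoc, sq, mul_one]
  · intro p q r x y z _ _ _
    refine ⟨0, ?_⟩
    obtain ⟨X, hX, rfl⟩ := ShufAux.ev_surj x
    obtain ⟨Y, hY, rfl⟩ := ShufAux.ev_surj y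
    obtain ⟨Z, hZ, rfl⟩ := ShufAux.ev_surj z
    rw [hs _ _ _ _ hX hY, hs _ _ _ _ hY hZ, hs _ _ _ _ (ShufAux.Sh_mem hX hY) hZ,
      hs _ _ _ _ hX (ShufAux.Sh_mem hY hZ), ShufAux.ev_reindex, map_zero, sub_eq_zero,
      ShufAux.Sh_assoc hX hY hZ]
  · intro p q x y _ _
    refine ⟨0, ?_⟩
    obtain ⟨X, hX, rfl⟩ := ShufAux.ev_surj x
    obtain ⟨Y, hY, rfl⟩ := ShufAux.ev_surj y
    rw [hs _ _ _ _ hX hY, hs _ _ _ _ hY hX, ShufAux.ev_reindex, map_zero, sub_eq_zero,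
      ← Int.cast_smul_eq_zsmul A, ← map_smul, ← ShufAux.Sh_comm hX hY]
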